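/- arXiv:1709.03186 — 3 statements merged into one kernel-verified Lean document; each statement's English description precedes it below -/
import Mathlib

section
/- Let A be a semiring with 1 ≠ 0. Every congruence on A that is maximal among congruences not relating 1 and 0 is a prime congruence. -/
/-- The twist product of pairs over a semiring. -/
def twist {A : Type*} [Semiring A] (p q : A × A) : A × A :=
  (p.1 * q.1 + p.2 * q.2, p.1 * q.2 + p.2 * q.1)

/-- `C₁ ⋄ C₂ ⊆ C`: C relates the two components of p⊙q whenever C₁ relates the
components of p and C₂ relates the components of q. -/
def DiamondLe {A : Type*} [Semiring A] (C₁ C₂ C : RingCon A) : Prop :=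
  ∀ p q : A × A, C₁ p.1 p.2 → C₂ q.1 q.2 → C (twist p q).1 (twist p q).2

/-- A prime congruence: not the all-relation, and C₁⋄C₂ ⊆ C implies C₁ ⊆ C or C₂ ⊆ C. -/
def IsPrimeCong {A : Type*} [Semiring A] (C : RingCon A) : Prop :=
  (∃ a b : A, ¬ C a b) ∧
  ∀ C₁ C₂ : RingCon A, DiamondLe C₁ C₂ C → C₁ ≤ C ∨ C₂ ≤ C

/-- The largest congruence for which the `C`-class of `0` is a union of classes. -/
def RingCon.zeroSyntactic {A : Type*} [Semiring A] (C : RingCon A) : RingCon A where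
  r x y := ∀ r s t : A, C (r * x * s + t) 0 ↔ C (r * y * s + t) 0
  iseqv :=
    ⟨fun _ _ _ _ => Iff.rfl, fun h r s t => (h r s t).symm,
      fun h h' r s t => (h r s t).trans (h' r s t)⟩
  add' {w x y z} h h' r s t := by
    have h₁ := h r s (r * y * s + t)
    have h₂ := h' r s (r * x * s + t)
    rw [show r * (w + y) * s + t = r * w * s + (r * y * s + t) by
        rw [mul_add, add_mul, add_assoc],
      show r * (x + z) * s + t = r * z * s + (r * x * s + t) by
        rw [mul_add, add_mul, add_comm (r * x * s), add_assoc], h₁, ← h₂, add_left_comm]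
  mul' {w x y z} h h' r s t := by
    have h₁ := h r (y * s) t
    have h₂ := h' (r * x) s t
    simp only [mul_assoc] at h₁ h₂ ⊢
    exact h₁.trans h₂

/-- The congruence relating `u` and `v` when `u * c * b` and `v * c * b` agree modulo `C`
for every `c`. -/
def RingCon.leftAnnihilator {A : Type*} [Semiring A] (C : RingCon A) (b : A) : RingCon A where
  r u v := ∀ c : A, C (u * c * b) (v * c * b)
  iseqv :=
    ⟨fun _ _ => C.refl _, fun h c => C.symm (h c), fun h h' c => C.trans (h c) (h' c)⟩
  add' h h' c := by
    simpa only [add_mul] using C.add (h c) (h' c)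
  mul' {w x y z} h h' c := by
    have h₁ := h (y * c)
    have h₂ := C.mul (C.refl x) (h' c)
    simp only [mul_assoc] at h₁ h₂ ⊢
    exact C.trans h₁ h₂

theorem RingCon.le_zeroSyntactic {A : Type*} [Semiring A] {C D : RingCon A}
    (h : ∀ x y, D x y → C x 0 → C y 0) : D ≤ C.zeroSyntactic := by
  intro x y hxy r s t
  have hD : D (r * x * s + t) (r * y * s + t) :=
    D.add (D.mul (D.mul (D.refl r) hxy) (D.refl s)) (D.refl t)
  exact ⟨h _ _ hD, h _ _ (D.symm hD)⟩

/-- A congruence not below a maximal proper `C` relates an element of the `C`-class of `0`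
to an element outside it. -/
theorem RingCon.exists_rel_zero_of_not_le {A : Type*} [Semiring A] {C D : RingCon A}
    (hC : ¬ C 1 0) (hmax : ∀ C' : RingCon A, ¬ C' 1 0 → C ≤ C' → C' = C) (hD : ¬ D ≤ C) :
    ∃ x y, D x y ∧ C x 0 ∧ ¬ C y 0 := by
  by_contra! h
  refine hD ?_
  rw [← hmax C.zeroSyntactic ?_
    (RingCon.le_zeroSyntactic fun x y hxy hx => C.trans (C.symm hxy) hx)]
  · exact RingCon.le_zeroSyntactic h
  · intro h10
    have h₁ := h10 1 1 0
    simp only [mul_one, mul_zero, add_zero] at h₁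
    exact hC (h₁.2 (C.refl 0))

/-- Let A be a semiring with 1 ≠ 0.  Every congruence on A that is maximal
among congruences not relating 1 and 0 is a prime congruence. -/
theorem stmt_7 {A : Type*} [Semiring A] (h10 : (1 : A) ≠ 0)
    (C : RingCon A) (hC : ¬ C 1 0)
    (hmax : ∀ C' : RingCon A, ¬ C' 1 0 → C ≤ C' → C' = C) :
    IsPrimeCong C := by
  refine ⟨⟨1, 0, hC⟩, fun C₁ C₂ hd => ?_⟩
  by_contra! hle
  obtain ⟨x, y, hxy, hx, hy⟩ := RingCon.exists_rel_zero_of_not_le hC hmax hle.1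
  obtain ⟨a, b, hab, ha, hb⟩ := RingCon.exists_rel_zero_of_not_le hC hmax hle.2
  have hzero (c : A) : C (y * c * b) 0 := by
    have h := hd (x, y) (c * a, c * b) hxy (C₂.mul (C₂.refl c) hab)
    simp only [twist] at h
    have h₁ : C (x * (c * a)) 0 := by simpa using C.mul hx (C.refl (c * a))
    have h₂ : C (x * (c * b)) 0 := by simpa using C.mul hx (C.refl (c * b))
    have h₃ : C (y * (c * a)) 0 := by
      simpa [mul_assoc] using C.mul (C.refl (y * c)) ha
    have h₄ := C.add h₁ (C.refl (y * (c * b)))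
    have h₅ := C.add h₂ h₃
    simp only [zero_add, add_zero] at h₄ h₅
    rw [mul_assoc]
    exact C.trans (C.symm h₄) (C.trans h h₅)
  have hann : C.leftAnnihilator b = C := by
    refine hmax _ (fun h => hb ?_) fun u v huv c =>
      C.mul (C.mul huv (C.refl c)) (C.refl b)
    simpa using h 1
  have hy₀ : C.leftAnnihilator b y 0 := fun c => by simpa using hzero c
  rw [hann] at hy₀
  exact hy hy₀
end

section
/- Let A be a semiring and let Δ denote the diagonal (equality) congruence on A. Then A is prime if and only if A is both semiprime and irreducible; that is: (for all congruences C₁, C₂, C₁⋄C₂ ⊆ Δ implies C₁ = Δ or C₂ = Δ) holds if and only if (for every congruence C, C⋄C ⊆ Δ implies C = Δ) and (for all congruences C₁, C₂, C₁ ∩ C₂ = Δ implies C₁ = Δ or C₂ = Δ) both hold. -/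
/-- The diagonal (equality) congruence on a semiring. -/
def diagCon (A : Type*) [Semiring A] : RingCon A where
  r := Eq
  iseqv := ⟨fun _ => rfl, Eq.symm, Eq.trans⟩
  mul' := by rintro a b c d rfl rfl; rfl
  add' := by rintro a b c d rfl rfl; rfl

theorem ringCon_twist_of_left {A : Type*} [Semiring A] (C : RingCon A) {p : A × A} (q : A × A)
    (hp : C p.1 p.2) : C (twist p q).1 (twist p q).2 := by
  have h := C.add (C.mul hp (C.refl q.1)) (C.mul (C.symm hp) (C.refl q.2))
  rwa [add_comm (p.2 * q.1)] at h

theorem ringCon_twist_of_right {A : Type*} [Semiring A] (C : RingCon A) (p : A × A) {q : A × A}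
    (hq : C q.1 q.2) : C (twist p q).1 (twist p q).2 :=
  C.add (C.mul (C.refl p.1) hq) (C.mul (C.refl p.2) (C.symm hq))

/-- A semiring A is prime iff it is semiprime and irreducible, in terms of
the diagonal congruence Δ:
(∀ C₁ C₂, C₁⋄C₂ ⊆ Δ → C₁ = Δ ∨ C₂ = Δ) ↔
((∀ C, C⋄C ⊆ Δ → C = Δ) ∧ (∀ C₁ C₂, C₁ ∩ C₂ = Δ → C₁ = Δ ∨ C₂ = Δ)). -/
theorem stmt_8 {A : Type*} [Semiring A] :
    (∀ C₁ C₂ : RingCon A, DiamondLe C₁ C₂ (diagCon A) → C₁ = diagCon A ∨ C₂ = diagCon A) ↔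
    ((∀ C : RingCon A, DiamondLe C C (diagCon A) → C = diagCon A) ∧
     (∀ C₁ C₂ : RingCon A, (∀ x y : A, (C₁ x y ∧ C₂ x y) ↔ x = y) →
        C₁ = diagCon A ∨ C₂ = diagCon A)) := by
  constructor
  · intro h
    refine ⟨fun C hC => (h C C hC).elim id id, fun C₁ C₂ hC => h C₁ C₂ fun p q hp hq => ?_⟩
    exact (hC _ _).1 ⟨ringCon_twist_of_left C₁ q hp, ringCon_twist_of_right C₂ p hq⟩
  · rintro ⟨hs, hi⟩ C₁ C₂ h
    have hΔ : C₁ ⊓ C₂ = diagCon A := hs _ fun p q hp hq => h p q hp.1 hq.2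
    refine hi C₁ C₂ fun x y => ?_
    change (C₁ ⊓ C₂) x y ↔ diagCon A x y
    rw [hΔ]
end

section
/- Let A be a commutative semiring, M an A-module, and ν : M → M an additive-monoid automorphism with ν∘ν = id and ν(a•x) = a•ν(x) for all a ∈ A, x ∈ M. Then M becomes a module over the symmetrized semiring Â = A×A (with twist multiplication) under the action (a₀,a₁)•x := a₀•x + a₁•ν(x). -/
/-- Let A be a commutative semiring, M an A-module, and ν : M → M an
additive-monoid automorphism with ν∘ν = id and ν(a•x) = a•ν(x).  Then M becomes a
module over the symmetrized semiring Â = A×A (with twist multiplication) under the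
action (a₀,a₁)•x := a₀•x + a₁•ν(x); i.e. this action satisfies all the module axioms
with respect to the twist semiring structure on A×A. -/
theorem stmt_14 {A M : Type*} [CommSemiring A] [AddCommMonoid M] [Module A M]
    (ν : M → M)
    (hadd : ∀ x y : M, ν (x + y) = ν x + ν y)
    (hzero : ν 0 = 0)
    (hinv : ∀ x : M, ν (ν x) = x)
    (hsmul : ∀ (a : A) (x : M), ν (a • x) = a • ν x) :
    ∀ act : (A × A) → M → M,
      (act = fun p x => p.1 • x + p.2 • ν x) →
      (∀ x : M, act ((1 : A), (0 : A)) x = x) ∧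
      (∀ (p q : A × A) (x : M), act (twist p q) x = act p (act q x)) ∧
      (∀ (p : A × A) (x y : M), act p (x + y) = act p x + act p y) ∧
      (∀ (p q : A × A) (x : M), act (p + q) x = act p x + act q x) ∧
      (∀ x : M, act ((0 : A), (0 : A)) x = 0) ∧
      (∀ p : A × A, act p (0 : M) = 0) := by
  rintro _ rfl
  refine ⟨fun x => by simp, fun p q x => ?_, fun p x y => ?_, fun p q x => ?_,
    fun x => by simp, fun p => by simp [hzero]⟩
  · simp only [twist, hadd, hsmul, hinv, add_smul, smul_add, mul_smul]
    abel
  · simp only [hadd, smul_add]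
    abel
  · simp only [Prod.fst_add, Prod.snd_add, add_smul]
    abel
end
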